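/- arXiv:1509.02449 — 2 statements merged into one kernel-verified Lean document; each statement's English description precedes it below -/
import Mathlib

section
/- Let k be a complete discretely valued nonarchimedean field with ring of integers k°, and let H be a bounded subgroup of GLₙ(k). Then there exists g ∈ GLₙ(k) such that gHg⁻¹ ⊆ GLₙ(k°). -/
open Matrix

/-- over a complete discretely valued nonarchimedean field `k`, every bounded
subgroup `H` of `GLₙ(k)` is conjugate into `GLₙ(k°)`: there is `g ∈ GLₙ(k)` such that all
elements of `gHg⁻¹` and their inverses have entries of absolute value at most `1`. -/
theorem stmt8 (k : Type*) [NontriviallyNormedField k] [IsUltrametricDist k] [CompleteSpace k]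
    (hdisc : ∃ π : k, π ≠ 0 ∧ ‖π‖ < 1 ∧ ∀ x : k, x ≠ 0 → ∃ m : ℤ, ‖x‖ = ‖π‖ ^ m)
    (n : ℕ) (H : Subgroup (GL (Fin n) k))
    (hbdd : ∃ C : ℝ, ∀ h ∈ H, ∀ i j,
      ‖(h : Matrix (Fin n) (Fin n) k) i j‖ ≤ C ∧
      ‖((h⁻¹ : GL (Fin n) k) : Matrix (Fin n) (Fin n) k) i j‖ ≤ C) :
    ∃ g : GL (Fin n) k, ∀ h ∈ H, ∀ i j,
      ‖((g * h * g⁻¹ : GL (Fin n) k) : Matrix (Fin n) (Fin n) k) i j‖ ≤ 1 ∧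
      ‖(((g * h * g⁻¹)⁻¹ : GL (Fin n) k) : Matrix (Fin n) (Fin n) k) i j‖ ≤ 1 := by
  obtain ⟨π, hπ0, hπ1, hπ⟩ := hdisc
  obtain ⟨C, hC⟩ := hbdd
  have hp0 : 0 < ‖π‖ := norm_pos_iff.mpr hπ0
  let E : Set (Fin n → k) := {v | ∃ h ∈ H, ∃ i, v = fun r => (h : Matrix (Fin n) (Fin n) k) r i}
  have hEb : ∀ v ∈ E, ∀ r, ‖v r‖ ≤ C := by
    rintro v ⟨h, hh, i, rfl⟩ r
    exact (hC h hh r i).1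
  have hEs : ∀ h ∈ H, ∀ v ∈ E, (h : Matrix (Fin n) (Fin n) k) *ᵥ v ∈ E := by
    rintro h hh v ⟨h', hh', i, rfl⟩
    exact ⟨h * h', H.mul_mem hh hh', i, by
      ext r; simp [Matrix.mul_apply, Matrix.mulVec, dotProduct]⟩
  let P : ℤ → Prop := fun m => ∃ A : Matrix (Fin n) (Fin n) k,
    (∀ j, (fun r => A r j) ∈ E) ∧ ‖A.det‖ = ‖π‖ ^ m
  have hP0 : P 0 := ⟨1, fun j => ⟨1, H.one_mem, j, by simp⟩, by simp⟩
  have hdet : ∀ A : Matrix (Fin n) (Fin n) k, (∀ j, (fun r => A r j) ∈ E) →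
      ‖A.det‖ ≤ (Nat.factorial n) • C ^ n := by
    intro A hA
    have := Matrix.det_le (A := A) (abv := NormedField.toAbsoluteValue k) (x := C)
      (fun i j => hEb _ (hA j) i)
    rw [Fintype.card_fin] at this
    exact this
  have hbd : ∃ b : ℤ, ∀ z, P z → b ≤ z := by
    obtain ⟨N, hN⟩ := pow_unbounded_of_one_lt ((Nat.factorial n) • C ^ n)
      ((one_lt_inv₀ hp0).mpr hπ1)
    refine ⟨-N, fun z ⟨A, hA, hz⟩ => ?_⟩
    by_contra! hlt
    have h1 := hdet A hA
    have h2 : ‖π‖ ^ (-(N:ℤ)) < ‖π‖ ^ z := zpow_lt_zpow_right_of_lt_one₀ hp0 hπ1 hlt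
    rw [_root_.zpow_neg, _root_.zpow_natCast, ← inv_pow] at h2
    linarith
  obtain ⟨m, ⟨A, hAE, hAm⟩, hmin⟩ := Int.exists_least_of_bdd hbd ⟨0, hP0⟩
  have hd0 : 0 < ‖A.det‖ := by rw [hAm]; positivity
  have hdne : A.det ≠ 0 := norm_pos_iff.mp hd0
  have hmax : ∀ v ∈ E, ∀ i, ‖(A⁻¹ *ᵥ v) i‖ ≤ 1 := by
    intro v hv i
    have hcr : (A⁻¹ *ᵥ v) i = A.det⁻¹ * (A.updateCol i v).det := by
      rw [Matrix.inv_def, Matrix.smul_mulVec, ← Matrix.cramer_eq_adjugate_mulVec,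
        Pi.smul_apply, Matrix.cramer_apply, Ring.inverse_eq_inv', smul_eq_mul]
    rw [hcr, norm_mul, norm_inv, inv_mul_le_one₀ hd0]
    by_cases hz : (A.updateCol i v).det = 0
    · rw [hz, norm_zero]; exact hd0.le
    obtain ⟨m', hm'⟩ := hπ _ hz
    have := hmin m' ⟨A.updateCol i v, fun j => by
      by_cases hj : j = i
      · subst hj; simpa using hv
      · simpa [Matrix.updateCol_apply, hj] using hAE j, hm'⟩
    rw [hm', hAm]
    exact zpow_le_zpow_right_of_le_one₀ hp0 hπ1.le this
  let g : GL (Fin n) k := Matrix.GeneralLinearGroup.mkOfDetNeZero A hdne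
  have hg : (g : Matrix (Fin n) (Fin n) k) = A := rfl
  have key : ∀ h ∈ H, ∀ i j,
      ‖((g⁻¹ * h * g⁻¹⁻¹ : GL (Fin n) k) : Matrix (Fin n) (Fin n) k) i j‖ ≤ 1 := by
    intro h hh i j
    have := hmax _ (hEs h hh _ (hAE j)) i
    rw [inv_inv, mul_assoc, Units.val_mul, Units.val_mul, Matrix.coe_units_inv, hg]
    exact this
  refine ⟨g⁻¹, fun h hh i j => ⟨key h hh i j, ?_⟩⟩
  have e : (g⁻¹ * h * g⁻¹⁻¹)⁻¹ = g⁻¹ * h⁻¹ * g⁻¹⁻¹ := by group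
  rw [e]
  exact key _ (H.inv_mem hh) i j
end

section
/- Let k be a complete nonarchimedean field with ring of integers k° and infinite residue field k̃, and let 𝒢 ⊆ GLₙ be a smooth affine group scheme over k° with connected geometric fibers whose special fiber is unirational over k̃. Then for every analytic field extension K of k, the K-holomorphically convex envelope of 𝒢(k°) equals 𝒢(K°): a point x ∈ 𝒢(K) satisfies |f(x)| ≤ sup_{s ∈ 𝒢(k°)} |f(s)| for all regular functions f on 𝒢_K if and only if x ∈ 𝒢(K°). -/
open scoped TensorProduct

/-- The ring of integers `k° = {x : ‖x‖ ≤ 1}` of a nonarchimedean field. -/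
noncomputable def intRing (k : Type*) [NontriviallyNormedField k] [IsUltrametricDist k] :
    Subring k where
  carrier := {x : k | ‖x‖ ≤ 1}
  zero_mem' := by simp
  one_mem' := by simp
  add_mem' := fun {a b} ha hb =>
    le_trans (IsUltrametricDist.norm_add_le_max a b) (max_le ha hb)
  neg_mem' := fun {a} ha => by simpa using ha
  mul_mem' := fun {a b} ha hb => by
    rw [Set.mem_setOf_eq, norm_mul]
    exact mul_le_one₀ ha (norm_nonneg b) hb

/-- The maximal ideal `k°° = {x : ‖x‖ < 1}` of the ring of integers. -/
noncomputable def maxIdeal (k : Type*) [NontriviallyNormedField k] [IsUltrametricDist k] :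
    Ideal (intRing k) where
  carrier := {x | ‖(x : k)‖ < 1}
  zero_mem' := by simp
  add_mem' := fun {a b} ha hb =>
    lt_of_le_of_lt (IsUltrametricDist.norm_add_le_max _ _) (max_lt ha hb)
  smul_mem' := fun c x hx => by
    have h : ‖(c : k) * (x : k)‖ ≤ ‖(x : k)‖ := by
      rw [norm_mul]
      exact mul_le_of_le_one_left (norm_nonneg _) c.property
    exact lt_of_le_of_lt h hx

universe u

section Helpers

variable {k : Type u} [NontriviallyNormedField k] [IsUltrametricDist k]

lemma mem_maxIdeal_iff (a : intRing k) : a ∈ maxIdeal k ↔ ‖(a : k)‖ < 1 := Iff.rfl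

lemma isUnit_of_notMem (a : intRing k) (ha : a ∉ maxIdeal k) : IsUnit a := by
  rw [mem_maxIdeal_iff, not_lt] at ha
  have h1 : ‖(a : k)‖ = 1 := le_antisymm a.2 ha
  have h0 : (a : k) ≠ 0 := by
    intro h
    rw [h] at h1
    simp at h1
  refine IsUnit.of_mul_eq_one ⟨(a : k)⁻¹, ?_⟩ ?_
  · change ‖(a : k)⁻¹‖ ≤ 1
    rw [norm_inv, h1, inv_one]
  · ext
    simp [h0]

lemma one_notMem_maxIdeal : (1 : intRing k) ∉ maxIdeal k := by
  rw [mem_maxIdeal_iff]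
  simp

lemma isField_residue : IsField ((intRing k) ⧸ (maxIdeal k)) := by
  refine ⟨⟨0, 1, ?_⟩, mul_comm, ?_⟩
  · intro h
    have := (Ideal.Quotient.eq_zero_iff_mem (I := maxIdeal k) (a := 1)).1 h.symm
    exact one_notMem_maxIdeal this
  · intro a ha
    obtain ⟨b, rfl⟩ := Ideal.Quotient.mk_surjective a
    have hb : b ∉ maxIdeal k := fun h => ha (Ideal.Quotient.eq_zero_iff_mem.2 h)
    obtain ⟨c, hc⟩ := (isUnit_of_notMem b hb).exists_right_inv
    exact ⟨Ideal.Quotient.mk _ c, by rw [← map_mul, hc, map_one]⟩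

lemma dvd_of_norm_le (a b : intRing k) (ha : a ≠ 0) (h : ‖(b : k)‖ ≤ ‖(a : k)‖) : a ∣ b := by
  have h0 : (a : k) ≠ 0 := by simpa using ha
  refine ⟨⟨(b : k) / a, ?_⟩, ?_⟩
  · change ‖(b : k) / a‖ ≤ 1
    rw [norm_div]
    exact div_le_one_of_le₀ h (norm_nonneg _)
  · ext
    simp only [Subring.coe_mul]
    field_simp

lemma norm_le_of_dvd (a b : intRing k) (h : a ∣ b) : ‖(b : k)‖ ≤ ‖(a : k)‖ := by
  obtain ⟨c, rfl⟩ := h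
  rw [Subring.coe_mul, norm_mul]
  exact mul_le_of_le_one_right (norm_nonneg _) c.2

lemma exists_uniformizer : ∃ a : intRing k, a ≠ 0 ∧ a ∈ maxIdeal k := by
  obtain ⟨a, h0, h1⟩ := NormedField.exists_norm_lt_one k
  refine ⟨⟨a, h1.le⟩, ?_, h1⟩
  intro h
  have : a = 0 := congrArg Subtype.val h
  rw [this] at h0
  simp at h0

lemma exists_common_dvd {ι : Type*} (S : Finset ι) (b : ι → intRing k)
    (hb : ∀ i ∈ S, b i ∈ maxIdeal k) :
    ∃ a : intRing k, a ≠ 0 ∧ a ∈ maxIdeal k ∧ ∀ i ∈ S, a ∣ b i := by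
  classical
  induction S using Finset.induction_on with
  | empty =>
    obtain ⟨a, h0, h1⟩ := exists_uniformizer (k := k)
    exact ⟨a, h0, h1, by simp⟩
  | insert i S hi ih =>
    obtain ⟨a, h0, h1, h2⟩ := ih (fun j hj => hb j (Finset.mem_insert_of_mem hj))
    by_cases h : ‖(b i : k)‖ ≤ ‖(a : k)‖
    · refine ⟨a, h0, h1, fun j hj => ?_⟩
      rcases Finset.mem_insert.1 hj with rfl | hj
      · exact dvd_of_norm_le _ _ h0 h
      · exact h2 j hj
    · have hb0 : b i ≠ 0 := by
        intro hh
        rw [hh] at h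
        simp at h
      refine ⟨b i, hb0, hb i (Finset.mem_insert_self _ _), fun j hj => ?_⟩
      rcases Finset.mem_insert.1 hj with rfl | hj
      · exact dvd_rfl
      · exact (dvd_of_norm_le _ _ hb0 (le_of_not_ge h)).trans (h2 j hj)

/-- the ring of integers of a complete field is adically complete -/
lemma isAdicComplete_span [CompleteSpace k] (a : intRing k) (h0 : a ≠ 0) (h1 : a ∈ maxIdeal k) :
    IsAdicComplete (Ideal.span {a}) (intRing k) := by
  have key : ∀ (n : ℕ) (x y : intRing k),
      x ≡ y [SMOD (Ideal.span {a} ^ n • ⊤ : Ideal (intRing k))] ↔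
        ‖(x : k) - y‖ ≤ ‖(a : k)‖ ^ n := by
    intro n x y
    rw [SModEq.sub_mem, smul_eq_mul, Ideal.mul_top, Ideal.span_singleton_pow,
      Ideal.mem_span_singleton, ← norm_pow]
    constructor
    · intro h
      simpa using norm_le_of_dvd _ _ h
    · intro h
      exact dvd_of_norm_le _ _ (pow_ne_zero _ h0) (by simpa using h)
  have hlim : Filter.Tendsto (fun n : ℕ => ‖(a : k)‖ ^ n) Filter.atTop (nhds 0) :=
    tendsto_pow_atTop_nhds_zero_of_lt_one (norm_nonneg _) h1
  have hH : IsHausdorff (Ideal.span {a}) (intRing k) := by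
    refine ⟨fun x hx => ?_⟩
    have : ‖(x : k)‖ ≤ 0 := by
      refine ge_of_tendsto' hlim fun n => ?_
      simpa using (key n x 0).1 (hx n)
    simpa using this
  have hP : IsPrecomplete (Ideal.span {a}) (intRing k) := by
    refine ⟨fun f hf => ?_⟩
    have hf' : ∀ m n, m ≤ n → ‖(f m : k) - f n‖ ≤ ‖(a : k)‖ ^ m :=
      fun m n h => (key m _ _).1 (hf h)
    have hc : CauchySeq (fun n => (f n : k)) := by
      refine cauchySeq_of_le_tendsto_0' (fun n => ‖(a : k)‖ ^ n) (fun m n h => ?_) hlim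
      rw [dist_eq_norm]
      exact hf' m n h
    obtain ⟨L, hL⟩ := cauchySeq_tendsto_of_complete hc
    have hL1 : ‖L‖ ≤ 1 := le_of_tendsto' hL.norm fun n => (f n).2
    refine ⟨⟨L, hL1⟩, fun n => (key n _ _).2 ?_⟩
    have ht : Filter.Tendsto (fun m => ‖(f n : k) - f m‖) Filter.atTop (nhds ‖(f n : k) - L‖) :=
      (tendsto_const_nhds.sub hL).norm
    refine le_of_tendsto ht ?_
    filter_upwards [Filter.eventually_ge_atTop n] with m hm using hf' n m hm
  exact { toIsHausdorff := hH, toIsPrecomplete := hP }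

/-- Hensel lifting -/
lemma exists_lift [CompleteSpace k] {R : Type u} [CommRing R] [Algebra (intRing k) R]
    [Algebra.FormallySmooth (intRing k) R] [Algebra.FinitePresentation (intRing k) R]
    (q : R →ₐ[intRing k] (intRing k) ⧸ (maxIdeal k)) :
    ∃ s : R →ₐ[intRing k] intRing k, ∀ r, Ideal.Quotient.mk (maxIdeal k) (s r) = q r := by
  obtain ⟨n, f, hf, G, hG⟩ := Algebra.FinitePresentation.out (R := intRing k) (A := R)
  choose y hy using fun i => Ideal.Quotient.mk_surjective (I := maxIdeal k) (q (f (MvPolynomial.X i)))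
  let ev : MvPolynomial (Fin n) (intRing k) →ₐ[intRing k] intRing k := MvPolynomial.aeval y
  have hev : (Ideal.Quotient.mkₐ (intRing k) (maxIdeal k)).comp ev = q.comp f := by
    apply MvPolynomial.algHom_ext
    intro i
    simp [ev, hy]
  have hev' : ∀ P, Ideal.Quotient.mk (maxIdeal k) (ev P) = q (f P) := fun P =>
    DFunLike.congr_fun hev P
  obtain ⟨a, h0, h1, h2⟩ := exists_common_dvd G (fun g => ev g) (by
    intro g hg
    rw [← Ideal.Quotient.eq_zero_iff_mem, hev']
    have : g ∈ RingHom.ker f.toRingHom := by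
      rw [← hG]
      exact Ideal.subset_span hg
    have h3 : f g = 0 := this
    rw [h3, map_zero])
  have := isAdicComplete_span a h0 h1
  have hker : ∀ P ∈ RingHom.ker f, (Ideal.Quotient.mkₐ (intRing k) (Ideal.span {a})).comp ev P = 0 := by
    intro P hP
    have hP' : P ∈ Ideal.span (G : Set (MvPolynomial (Fin n) (intRing k))) := by
      rw [hG]
      exact hP
    have hle : Ideal.span (G : Set (MvPolynomial (Fin n) (intRing k))) ≤
        (Ideal.span {a}).comap ev := by
      rw [Ideal.span_le]
      intro g hg
      exact Ideal.mem_span_singleton.2 (h2 g hg)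
    exact Ideal.Quotient.eq_zero_iff_mem.2 (hle hP')
  let g0 : R →ₐ[intRing k] (intRing k) ⧸ Ideal.span {a} :=
    (Ideal.Quotient.liftₐ (RingHom.ker f) _ hker).comp
      (Ideal.quotientKerAlgEquivOfSurjective hf).symm.toAlgHom
  have hg0 : ∀ P, g0 (f P) = Ideal.Quotient.mk (Ideal.span {a}) (ev P) := by
    intro P
    have : (Ideal.quotientKerAlgEquivOfSurjective hf).symm (f P) =
        Ideal.Quotient.mk (RingHom.ker f) P := by
      rw [AlgEquiv.symm_apply_eq]
      rfl
    simp only [g0, AlgHom.comp_apply, AlgEquiv.toAlgHom_apply, this]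
    rfl
  obtain ⟨s, hs⟩ := Algebra.FormallySmooth.exists_mkₐ_comp_eq_of_isAdicComplete g0
  refine ⟨s, fun r => ?_⟩
  obtain ⟨P, rfl⟩ := hf r
  have h3 : Ideal.Quotient.mk (Ideal.span {a}) (s (f P)) = Ideal.Quotient.mk _ (ev P) := by
    rw [← hg0]
    exact DFunLike.congr_fun hs (f P)
  rw [← hev', Ideal.Quotient.eq]
  rw [Ideal.Quotient.eq, Ideal.mem_span_singleton] at h3
  exact (maxIdeal k).mem_of_dvd h3 h1

/-- kernel of reduction -/
lemma exists_of_reduction_eq_zero {R : Type u} [CommRing R] [Algebra (intRing k) R] (r : R)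
    (hr : (1 : (intRing k) ⧸ (maxIdeal k)) ⊗ₜ[intRing k] r = 0) :
    ∃ a ∈ maxIdeal k, ∃ r' : R, r = algebraMap (intRing k) R a * r' := by
  have h1 : r ∈ (maxIdeal k • ⊤ : Submodule (intRing k) R) := by
    have h2 := TensorProduct.quotTensorEquivQuotSMul_mk_tmul (I := maxIdeal k) 1 r
    rw [map_one, hr, map_zero, one_smul] at h2
    exact (Submodule.Quotient.mk_eq_zero _).1 h2.symm
  clear hr
  refine Submodule.smul_induction_on
    (p := fun r => ∃ a ∈ maxIdeal k, ∃ r' : R, r = algebraMap (intRing k) R a * r') h1 ?_ ?_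
  · exact fun a ha n hn => ⟨a, ha, n, by rw [Algebra.smul_def]⟩
  · intro x y hx hy
    obtain ⟨a, ha, x', rfl⟩ := hx
    obtain ⟨b, hb, y', rfl⟩ := hy
    obtain ⟨c, h0, h1, h2⟩ := exists_common_dvd (Finset.univ : Finset (Fin 2)) ![a, b] (by
      intro i _
      fin_cases i
      · exact ha
      · exact hb)
    obtain ⟨a', ha'⟩ := h2 0 (by simp)
    obtain ⟨b', hb'⟩ := h2 1 (by simp)
    simp at ha' hb'
    refine ⟨c, h1, algebraMap _ R a' * x' + algebraMap _ R b' * y', ?_⟩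
    rw [ha', hb']
    simp only [map_mul]
    ring

end Helpers
section Density

lemma exists_functional {F M : Type*} [CommRing F] (hF : IsField F) [AddCommGroup M] [Module F M]
    (v : M) (hv : v ≠ 0) : ∃ l : M →ₗ[F] F, l v ≠ 0 := by
  let := hF.toField
  by_contra! hcon
  exact hv ((Module.forall_dual_apply_eq_zero_iff F v).1 hcon)

/-- density of rational points -/
lemma exists_point {F A : Type*} [CommRing F] [Infinite F] (hF : IsField F) [CommRing A] [Algebra F A]
    [Algebra.FiniteType F A] (N : ℕ)
    (φ : A →ₐ[F] FractionRing (MvPolynomial (Fin N) F)) (hφ : Function.Injective φ)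
    (h : A) (hh : h ≠ 0) : ∃ p : A →ₐ[F] F, p h ≠ 0 := by
  classical
  have : IsDomain F := hF.isDomain
  obtain ⟨S, hS⟩ := Algebra.FiniteType.out (R := F) (A := A)
  have hfrac : ∀ z : FractionRing (MvPolynomial (Fin N) F), ∃ P Q : MvPolynomial (Fin N) F,
      Q ≠ 0 ∧ z = algebraMap _ _ P * (algebraMap _ _ Q)⁻¹ := by
    intro z
    obtain ⟨P, Q, hQ, rfl⟩ := IsFractionRing.div_surjective (MvPolynomial (Fin N) F) z
    exact ⟨P, Q, nonZeroDivisors.ne_zero hQ, div_eq_mul_inv _ _⟩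
  choose P Q hQ hPQ using fun a : A => hfrac (φ a)
  have hP : P h ≠ 0 := by
    intro h0
    have := hPQ h
    rw [h0, map_zero, zero_mul, map_eq_zero_iff _ hφ] at this
    exact hh this
  have hprod : P h * Q h * ∏ a ∈ S, Q a ≠ 0 :=
    mul_ne_zero (mul_ne_zero hP (hQ h)) (Finset.prod_ne_zero_iff.2 fun a _ => hQ a)
  obtain ⟨t, ht⟩ : ∃ t : Fin N → F, MvPolynomial.eval t (P h * Q h * ∏ a ∈ S, Q a) ≠ 0 := by
    by_contra! hcon
    exact hprod (MvPolynomial.funext fun t => by rw [hcon t, map_zero])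
  rw [map_mul, map_mul, map_prod, mul_ne_zero_iff, mul_ne_zero_iff, Finset.prod_ne_zero_iff] at ht
  obtain ⟨⟨ht1, ht2⟩, ht3⟩ := ht
  let M : Submonoid (MvPolynomial (Fin N) F) := (nonZeroDivisors F).comap (MvPolynomial.eval t)
  have hM : ∀ q, q ∈ M ↔ MvPolynomial.eval t q ≠ 0 := fun q => by
    simp only [M, Submonoid.mem_comap, mem_nonZeroDivisors_iff_ne_zero]
  have hM0 : M ≤ nonZeroDivisors _ := fun q hq => by
    rw [mem_nonZeroDivisors_iff_ne_zero]
    rintro rfl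
    simp [hM] at hq
  let L := Localization.subalgebra.ofField (FractionRing (MvPolynomial (Fin N) F)) M hM0
  have hL : ∀ a, a ∈ S → φ a ∈ L := fun a ha => ⟨P a, Q a, (hM _).2 (ht3 a ha), hPQ a⟩
  have hLF : ∀ a : A, φ a ∈ L.restrictScalars F := by
    have : (⊤ : Subalgebra F A) ≤ (L.restrictScalars F).comap φ := by
      rw [← hS, Algebra.adjoin_le_iff]
      intro a ha
      exact hL a ha
    intro a
    exact this trivial
  have hunit : ∀ q : M, IsUnit ((MvPolynomial.aeval t : MvPolynomial (Fin N) F →ₐ[F] F) q) := by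
    intro q
    have := (hM q).1 q.2
    obtain ⟨b, hb⟩ := hF.mul_inv_cancel this
    exact IsUnit.of_mul_eq_one b hb
  let ev : L →+* F := IsLocalization.lift (M := M) (S := L)
    (g := (MvPolynomial.aeval t : MvPolynomial (Fin N) F →ₐ[F] F).toRingHom) hunit
  have hev : ∀ q, ev (algebraMap _ L q) = MvPolynomial.eval t q := fun q =>
    IsLocalization.lift_eq (M := M) (S := L) _ q
  let φ' : A →ₐ[F] L.restrictScalars F := φ.codRestrict _ hLF
  let p : A →+* F := ev.comp φ'.toRingHom
  have hp : ∀ c : F, p (algebraMap F A c) = c := by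
    intro c
    have : φ' (algebraMap F A c) = algebraMap (MvPolynomial (Fin N) F) L (MvPolynomial.C c) := by
      rw [φ'.commutes]
      rfl
    have h2 : p (algebraMap F A c) = ev (φ' (algebraMap F A c)) := rfl
    rw [h2, this]
    exact (hev _).trans (by simp)
  refine ⟨{ p with commutes' := hp }, ?_⟩
  change p h ≠ 0
  have h3 : (show L from φ' h) * algebraMap (MvPolynomial (Fin N) F) L (Q h) =
      algebraMap (MvPolynomial (Fin N) F) L (P h) := by
    apply Subtype.ext
    change φ h * algebraMap (MvPolynomial (Fin N) F) _ (Q h) = algebraMap (MvPolynomial (Fin N) F) _ (P h)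
    rw [hPQ h, mul_assoc, inv_mul_cancel₀, mul_one]
    rw [Ne, FaithfulSMul.algebraMap_eq_zero_iff]
    exact hQ h
  have h4 : p h * MvPolynomial.eval t (Q h) = MvPolynomial.eval t (P h) := by
    rw [← hev, ← hev, ← h3, map_mul]
    rfl
  intro h5
  rw [h5, zero_mul] at h4
  exact ht1 h4.symm

end Density
section Groebner

variable {k : Type u} [NontriviallyNormedField k] [IsUltrametricDist k]

/-- Standard monomials: a family which is independent in the special fibre and spans modulo
a small constant. -/
lemma exists_standard {R B : Type*} [CommRing R] [CommRing B] [Algebra (intRing k) R] (π : R →+* B)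
    (hπ : ∀ r, π r = 0 ↔ ∃ a ∈ maxIdeal k, ∃ r' : R, r = algebraMap (intRing k) R a * r')
    {N : ℕ} (ψ : MvPolynomial (Fin N) (intRing k) →ₐ[intRing k] R) (hψ : Function.Surjective ψ) :
    ∃ (E : Set (Fin N →₀ ℕ)) (a : intRing k), a ∈ maxIdeal k ∧
      (∀ r : R, ∃ P : MvPolynomial (Fin N) (intRing k), (∀ e ∈ P.support, e ∈ E) ∧
        ∃ r', r = ψ P + algebraMap (intRing k) R a * r') ∧
      (∀ P : MvPolynomial (Fin N) (intRing k), (∀ e ∈ P.support, e ∈ E) → π (ψ P) = 0 →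
        ∀ e, P.coeff e ∈ maxIdeal k) := by
  classical
  let m : MonomialOrder (Fin N) := MonomialOrder.degLex
  let D : Set (Fin N →₀ ℕ) := {d | ∃ G : MvPolynomial (Fin N) (intRing k),
    m.degree G = d ∧ IsUnit (m.leadingCoeff G) ∧ π (ψ G) = 0}
  have hfin : {d | Minimal (· ∈ D) d}.Finite :=
    WellQuasiOrderedLE.finite_of_isAntichain (setOfPred_minimal_antichain _)
  have hG : ∀ d : {d | Minimal (· ∈ D) d}, ∃ G : MvPolynomial (Fin N) (intRing k),
      m.degree G = d.1 ∧ IsUnit (m.leadingCoeff G) ∧ π (ψ G) = 0 := fun d => d.2.1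
  choose G hG1 hG2 hG3 using hG
  have hGa := fun d => (hπ _).1 (hG3 d)
  choose b hb ρ hρ using hGa
  have := hfin.fintype
  obtain ⟨a, h0, h1, h2⟩ := exists_common_dvd Finset.univ b (fun d _ => hb d)
  refine ⟨{e | ∀ d ∈ D, ¬ d ≤ e}, a, h1, ?_, ?_⟩
  · intro r
    obtain ⟨P, rfl⟩ := hψ r
    obtain ⟨g, P', hP, -, hP'⟩ := m.div hG2 P
    refine ⟨P', ?_, ?_⟩
    · intro e he d hd hde
      obtain ⟨d', hd', hmin⟩ := exists_minimal_le_of_wellFoundedLT (· ∈ D) d hd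
      have := hP' e he ⟨d', hmin⟩
      rw [hG1] at this
      exact this (hd'.trans hde)
    · choose b' hb' using fun d => h2 d (Finset.mem_univ d)
      refine ⟨g.sum fun d q => ψ q * (algebraMap _ R (b' d) * ρ d), ?_⟩
      conv_lhs => rw [hP]
      rw [map_add, add_comm, Finsupp.linearCombination_apply, Finsupp.sum, Finsupp.sum, map_sum,
        Finset.mul_sum]
      congr 1
      refine Finset.sum_congr rfl fun d _ => ?_
      rw [smul_eq_mul, map_mul, hρ d, hb' d, map_mul]
      ring
  · intro P hP hP0
    by_contra! hcon
    obtain ⟨e0, he0⟩ := hcon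
    let P' : MvPolynomial (Fin N) (intRing k) :=
      ∑ e ∈ P.support.filter (fun e => P.coeff e ∉ maxIdeal k), MvPolynomial.monomial e (P.coeff e)
    let P'' : MvPolynomial (Fin N) (intRing k) :=
      ∑ e ∈ P.support.filter (fun e => ¬ (P.coeff e ∉ maxIdeal k)),
        MvPolynomial.monomial e (P.coeff e)
    have hsum : P' + P'' = P := by
      simp only [P', P'']
      rw [Finset.sum_filter_add_sum_filter_not]
      exact P.support_sum_monomial_coeff
    have hP'' : π (ψ P'') = 0 := by
      simp only [P'', map_sum]
      refine Finset.sum_eq_zero fun e he => ?_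
      rw [Finset.mem_filter, not_not] at he
      rw [hπ]
      refine ⟨P.coeff e, he.2, ψ (MvPolynomial.monomial e 1), ?_⟩
      rw [← Algebra.smul_def, ← map_smul, MvPolynomial.smul_monomial, smul_eq_mul, mul_one]
    have hP' : π (ψ P') = 0 := by
      rw [← hsum, map_add, map_add, hP'', add_zero] at hP0
      exact hP0
    have hcoeff : ∀ e, P'.coeff e = if P.coeff e ∉ maxIdeal k then P.coeff e else 0 := by
      intro e
      simp only [P', MvPolynomial.coeff_sum, MvPolynomial.coeff_monomial]
      rw [Finset.sum_ite_eq']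
      by_cases h : P.coeff e ∈ maxIdeal k
      · simp [h]
      · have : P.coeff e ≠ 0 := fun hh => h (by rw [hh]; exact Ideal.zero_mem _)
        simp [h, this]
    have hne : P' ≠ 0 := by
      intro h
      have := hcoeff e0
      rw [h, if_pos he0, MvPolynomial.coeff_zero] at this
      exact he0 (by rw [← this]; exact Ideal.zero_mem _)
    have hlc : m.leadingCoeff P' ≠ 0 := MonomialOrder.leadingCoeff_ne_zero_iff.2 hne
    have hlc2 : m.leadingCoeff P' = P'.coeff (m.degree P') := rfl
    rw [hlc2, hcoeff] at hlc
    have hu : P.coeff (m.degree P') ∉ maxIdeal k := by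
      intro h
      rw [if_neg (not_not.2 h)] at hlc
      exact hlc rfl
    have hD : m.degree P' ∈ D := by
      refine ⟨P', rfl, ?_, hP'⟩
      rw [hlc2, hcoeff, if_pos hu]
      exact isUnit_of_notMem _ hu
    refine hP (m.degree P') ?_ _ hD le_rfl
    rw [MvPolynomial.mem_support_iff]
    intro h
    exact hu (by rw [h]; exact Ideal.zero_mem _)

lemma exists_standard_pow {R : Type*} [CommRing R] [Algebra (intRing k) R]
    {N : ℕ} (ψ : MvPolynomial (Fin N) (intRing k) →ₐ[intRing k] R)
    (E : Set (Fin N →₀ ℕ)) (a : intRing k)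
    (h : ∀ r : R, ∃ P : MvPolynomial (Fin N) (intRing k), (∀ e ∈ P.support, e ∈ E) ∧
        ∃ r', r = ψ P + algebraMap (intRing k) R a * r') (n : ℕ) :
    ∀ r : R, ∃ P : MvPolynomial (Fin N) (intRing k), (∀ e ∈ P.support, e ∈ E) ∧
        ∃ r', r = ψ P + algebraMap (intRing k) R (a ^ n) * r' := by
  classical
  induction n with
  | zero => exact fun r => ⟨0, by simp, r, by simp⟩
  | succ n ih =>
    intro r
    obtain ⟨P, hP, r', hr⟩ := ih r
    obtain ⟨P', hP', r'', hr'⟩ := h r'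
    refine ⟨P + a ^ n • P', ?_, r'', ?_⟩
    · intro e he
      rcases Finset.mem_union.1 (MvPolynomial.support_add he) with h | h
      · exact hP e h
      · exact hP' e (MvPolynomial.support_smul h)
    · rw [hr, hr', map_add, map_smul, Algebra.smul_def, pow_succ, map_mul]
      ring

end Groebner
section Final

variable {k : Type u} [NontriviallyNormedField k] [IsUltrametricDist k] [CompleteSpace k]

lemma exists_good_point
    [Infinite ((intRing k) ⧸ (maxIdeal k))]
    {R : Type u} [CommRing R] [Algebra (intRing k) R]
    [Algebra.FormallySmooth (intRing k) R] [Algebra.FinitePresentation (intRing k) R]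
    (hunir : ∃ (N : ℕ)
      (φ : (((intRing k) ⧸ (maxIdeal k)) ⊗[intRing k] R) →ₐ[(intRing k) ⧸ (maxIdeal k)]
        FractionRing (MvPolynomial (Fin N) ((intRing k) ⧸ (maxIdeal k)))),
      Function.Injective φ)
    {K : Type*} [NontriviallyNormedField K] [IsUltrametricDist K]
    (σ : k →+* K) (hσ : ∀ c : k, ‖σ c‖ = ‖c‖)
    {ι : Type*} (T : Finset ι) (ε : ι → R)
    (hind : ∀ w : ι → intRing k,
      (1 : (intRing k) ⧸ (maxIdeal k)) ⊗ₜ[intRing k] (∑ i ∈ T, algebraMap _ R (w i) * ε i) = 0 →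
      ∀ i ∈ T, w i ∈ maxIdeal k)
    (A : ι → K) (i0 : ι) (hi0 : i0 ∈ T) (hA0 : A i0 ≠ 0) (hA : ∀ i ∈ T, ‖A i‖ ≤ ‖A i0‖) :
    ∃ s : R →ₐ[intRing k] intRing k, ‖A i0‖ ≤ ‖∑ i ∈ T, A i * σ (s (ε i) : k)‖ := by
  classical
  obtain ⟨N, φ, hφ⟩ := hunir
  -- the map of residue rings
  let σ0 : intRing k →+* intRing K := (σ.comp (intRing k).subtype).codRestrict (intRing K)
    (fun c => by
      change ‖σ (c : k)‖ ≤ 1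
      rw [hσ]
      exact c.2)
  have hσ0 : ∀ c, ((σ0 c : intRing K) : K) = σ (c : k) := fun c => rfl
  let τ : (intRing k) ⧸ (maxIdeal k) →+* (intRing K) ⧸ (maxIdeal K) :=
    Ideal.Quotient.lift _ ((Ideal.Quotient.mk (maxIdeal K)).comp σ0) (fun c hc => by
      rw [RingHom.comp_apply, Ideal.Quotient.eq_zero_iff_mem]
      change ‖σ (c : k)‖ < 1
      rw [hσ]
      exact hc)
  have hτ : ∀ c, τ (Ideal.Quotient.mk _ c) = Ideal.Quotient.mk _ (σ0 c) := fun c => rfl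
  let _ : Module ((intRing k) ⧸ (maxIdeal k)) ((intRing K) ⧸ (maxIdeal K)) := τ.toModule
  have hsm : ∀ (c : (intRing k) ⧸ (maxIdeal k)) (z : (intRing K) ⧸ (maxIdeal K)),
      c • z = τ c * z := fun c z => rfl
  obtain ⟨l, hl⟩ := exists_functional (isField_residue (k := k))
    (1 : (intRing K) ⧸ (maxIdeal K)) (fun h => by
      rw [← map_one (Ideal.Quotient.mk _), Ideal.Quotient.eq_zero_iff_mem] at h
      exact one_notMem_maxIdeal h)
  let U : ι → intRing K := fun i => if h : ‖A i / A i0‖ ≤ 1 then ⟨A i / A i0, h⟩ else 0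
  have hU : ∀ i ∈ T, ((U i : intRing K) : K) = A i / A i0 := by
    intro i hi
    have h : ‖A i / A i0‖ ≤ 1 := by
      rw [norm_div]
      exact div_le_one_of_le₀ (hA i hi) (norm_nonneg _)
    simp only [U, dif_pos h]
  have hU0 : U i0 = 1 := by
    ext
    rw [hU i0 hi0, div_self hA0]
    rfl
  choose w hw using fun i => Ideal.Quotient.mk_surjective (l (Ideal.Quotient.mk _ (U i)))
  have hne : (1 : (intRing k) ⧸ (maxIdeal k)) ⊗ₜ[intRing k]
      (∑ i ∈ T, algebraMap _ R (w i) * ε i) ≠ 0 := by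
    intro h
    have := hind w h i0 hi0
    rw [← Ideal.Quotient.eq_zero_iff_mem, hw, hU0, map_one] at this
    exact hl this
  obtain ⟨p, hp⟩ := exists_point (F := (intRing k) ⧸ (maxIdeal k))
    (A := ((intRing k) ⧸ (maxIdeal k)) ⊗[intRing k] R) (isField_residue (k := k)) N φ hφ
    (1 ⊗ₜ (∑ i ∈ T, algebraMap _ R (w i) * ε i)) (fun h => hne h)
  let q : R →ₐ[intRing k] (intRing k) ⧸ (maxIdeal k) :=
    (p.restrictScalars (intRing k)).comp Algebra.TensorProduct.includeRight
  have hq : ∀ r, q r = p (1 ⊗ₜ r) := fun r => rfl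
  obtain ⟨s, hs⟩ := exists_lift q
  refine ⟨s, ?_⟩
  by_contra! hcon
  have hlt : ∑ i ∈ T, U i * σ0 (s (ε i)) ∈ maxIdeal K := by
    rw [mem_maxIdeal_iff]
    have : ((∑ i ∈ T, U i * σ0 (s (ε i)) : intRing K) : K) =
        (∑ i ∈ T, A i * σ (s (ε i) : k)) / A i0 := by
      rw [AddSubmonoidClass.coe_finsetSum, Finset.sum_div]
      refine Finset.sum_congr rfl fun i hi => ?_
      rw [Subring.coe_mul, hU i hi, hσ0]
      ring
    rw [this, norm_div]
    exact (div_lt_one (norm_pos_iff.2 hA0)).2 hcon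
  rw [← Ideal.Quotient.eq_zero_iff_mem, map_sum] at hlt
  have h2 := congrArg l hlt
  rw [map_sum, map_zero] at h2
  apply hp
  rw [← hq, map_sum, ← h2]
  refine Finset.sum_congr rfl fun i hi => ?_
  rw [map_mul, map_mul, mul_comm (Ideal.Quotient.mk _ (U i)), ← hτ, ← hsm, map_smul, hs, ← hw,
    q.commutes, smul_eq_mul, mul_comm]
  rfl

lemma norm_sum_le_of {K : Type*} [NormedField K] [IsUltrametricDist K] {ι : Type*}
    (T : Finset ι) (f : ι → K) (C : ℝ) (hC : 0 ≤ C) (h : ∀ i ∈ T, ‖f i‖ ≤ C) :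
    ‖∑ i ∈ T, f i‖ ≤ C :=
  IsUltrametricDist.norm_sum_le_of_forall_le_of_nonneg hC h

theorem main_hard
    [Infinite ((intRing k) ⧸ (maxIdeal k))]
    (R : Type u) [CommRing R] [Algebra (intRing k) R]
    [Algebra.FormallySmooth (intRing k) R] [Algebra.FinitePresentation (intRing k) R]
    (hemb : ∃ (N : ℕ) (ψ : MvPolynomial (Fin N) (intRing k) →ₐ[intRing k] R),
      Function.Surjective ψ)
    (hunir : ∃ (N : ℕ)
      (φ : (((intRing k) ⧸ (maxIdeal k)) ⊗[intRing k] R) →ₐ[(intRing k) ⧸ (maxIdeal k)]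
        FractionRing (MvPolynomial (Fin N) ((intRing k) ⧸ (maxIdeal k)))),
      Function.Injective φ)
    (K : Type*) [NontriviallyNormedField K] [IsUltrametricDist K]
    (σ : k →+* K) (hσ : ∀ c : k, ‖σ c‖ = ‖c‖)
    (x : R →+* K) (hx : ∀ c : intRing k, x (algebraMap (intRing k) R c) = σ c)
    (hx1 : ∀ r : R, ‖x r‖ ≤ 1) (m : ℕ) (c : Fin m → K) (r : Fin m → R) :
    ‖∑ i, c i * x (r i)‖ ≤
          sSup {t : ℝ | ∃ s : R →+* intRing k,
            (∀ a : intRing k, s (algebraMap (intRing k) R a) = a) ∧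
            t = ‖∑ i, c i * σ ((s (r i) : intRing k) : k)‖} := by
  classical
  by_cases hf0 : ∑ i, c i * x (r i) = 0
  · rw [hf0, norm_zero]
    apply Real.sSup_nonneg
    rintro t ⟨s, -, rfl⟩
    exact norm_nonneg _
  have hfpos := norm_pos_iff.2 hf0
  obtain ⟨N, ψ, hψ⟩ := hemb
  let π : R →+* ((intRing k) ⧸ (maxIdeal k)) ⊗[intRing k] R :=
    (Algebra.TensorProduct.includeRight : R →ₐ[intRing k] _).toRingHom
  have hπ1 : ∀ r, π r = 1 ⊗ₜ r := fun r => rfl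
  have hπ : ∀ r, π r = 0 ↔ ∃ a ∈ maxIdeal k, ∃ r' : R, r = algebraMap (intRing k) R a * r' := by
    intro r
    constructor
    · exact fun h => exists_of_reduction_eq_zero r h
    · rintro ⟨a, ha, r', rfl⟩
      rw [hπ1, ← Algebra.smul_def, ← TensorProduct.smul_tmul, Algebra.smul_def, mul_one]
      have : algebraMap (intRing k) ((intRing k) ⧸ (maxIdeal k)) a = 0 :=
        Ideal.Quotient.eq_zero_iff_mem.2 ha
      rw [this, TensorProduct.zero_tmul]
  obtain ⟨E, a, ha, hspan, hind⟩ := exists_standard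
    (B := ((intRing k) ⧸ (maxIdeal k)) ⊗[intRing k] R) π hπ ψ hψ
  -- a bound for the constants
  obtain ⟨C, hC0, hC⟩ : ∃ C : ℝ, 0 ≤ C ∧ ∀ i, ‖c i‖ ≤ C :=
    ⟨∑ i, ‖c i‖, Finset.sum_nonneg fun i _ => norm_nonneg _, fun i =>
      Finset.single_le_sum (f := fun i => ‖c i‖) (fun i _ => norm_nonneg _) (Finset.mem_univ i)⟩
  have hlim : Filter.Tendsto (fun n : ℕ => ‖(a : k)‖ ^ n * C) Filter.atTop (nhds (0 * C)) :=
    (tendsto_pow_atTop_nhds_zero_of_lt_one (norm_nonneg _) ha).mul_const C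
  rw [zero_mul] at hlim
  obtain ⟨n, hn⟩ := (hlim.eventually (gt_mem_nhds hfpos)).exists
  choose P hP h hr using fun i => exists_standard_pow ψ E a hspan n (r i)
  let T : Finset (Fin N →₀ ℕ) := Finset.univ.biUnion fun i => (P i).support
  have hTE : ∀ e ∈ T, e ∈ E := by
    intro e he
    obtain ⟨i, -, hi⟩ := Finset.mem_biUnion.1 he
    exact hP i e hi
  let ε : (Fin N →₀ ℕ) → R := fun e => ψ (MvPolynomial.monomial e 1)
  let A : (Fin N →₀ ℕ) → K := fun e => ∑ i, c i * σ (((P i).coeff e : intRing k) : k)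
  have hψP : ∀ i, ψ (P i) = ∑ e ∈ T, algebraMap _ R ((P i).coeff e) * ε e := by
    intro i
    conv_lhs => rw [← (P i).support_sum_monomial_coeff, map_sum]
    rw [← Finset.sum_subset (Finset.subset_biUnion_of_mem (fun i => (P i).support)
      (Finset.mem_univ i))]
    · refine Finset.sum_congr rfl fun e _ => ?_
      rw [← Algebra.smul_def, ← map_smul, MvPolynomial.smul_monomial, smul_eq_mul, mul_one]
    · intro e _ he
      rw [MvPolynomial.notMem_support_iff.1 he, map_zero, zero_mul]
  -- expansion of the function at any integral point
  have hexp : ∀ y : R →+* K, (∀ c : intRing k, y (algebraMap (intRing k) R c) = σ c) →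
      ∑ i, c i * y (r i) = ∑ e ∈ T, A e * y (ε e) + ∑ i, c i * (σ ((a : k) ^ n) * y (h i)) := by
    intro y hy
    have h1 : ∀ i, y (r i) = ∑ e ∈ T, σ (((P i).coeff e : intRing k) : k) * y (ε e) + σ ((a : k) ^ n) * y (h i) := by
      intro i
      conv_lhs => rw [hr i, hψP i]
      rw [map_add, map_sum, map_mul, hy]
      congr 1
      refine Finset.sum_congr rfl fun e _ => ?_
      rw [map_mul, hy]
    simp only [h1, mul_add, Finset.sum_add_distrib, A, Finset.sum_mul, Finset.mul_sum]
    congr 1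
    rw [Finset.sum_comm]
    refine Finset.sum_congr rfl fun e _ => Finset.sum_congr rfl fun i _ => ?_
    ring
  have hsmall : ∀ y : R →+* K, (∀ r, ‖y r‖ ≤ 1) →
      ‖∑ i, c i * (σ ((a : k) ^ n) * y (h i))‖ ≤ ‖(a : k)‖ ^ n * C := by
    intro y hy
    refine norm_sum_le_of _ _ _ (by positivity) fun i _ => ?_
    rw [norm_mul, norm_mul, hσ, norm_pow, mul_comm]
    refine mul_le_mul ?_ (hC i) (norm_nonneg _) (by positivity)
    exact mul_le_of_le_one_right (by positivity) (hy _)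
  have hbig : ‖∑ i, c i * x (r i)‖ ≤ ‖∑ e ∈ T, A e * x (ε e)‖ := by
    by_contra! hcon
    have h1 := IsUltrametricDist.norm_add_le_max (∑ e ∈ T, A e * x (ε e))
      (∑ i, c i * (σ ((a : k) ^ n) * x (h i)))
    rw [← hexp x hx] at h1
    exact absurd h1 (not_le.2 (max_lt hcon ((hsmall x hx1).trans_lt hn)))
  have hTne : T.Nonempty := by
    rw [Finset.nonempty_iff_ne_empty]
    intro h
    rw [h, Finset.sum_empty, norm_zero] at hbig
    exact absurd hbig (not_le.2 hfpos)
  obtain ⟨e0, he0, hmax⟩ := Finset.exists_max_image T (fun e => ‖A e‖) hTne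
  have hle : ‖∑ i, c i * x (r i)‖ ≤ ‖A e0‖ := by
    refine hbig.trans (norm_sum_le_of _ _ _ (norm_nonneg _) fun e he => ?_)
    rw [norm_mul]
    exact (mul_le_of_le_one_right (norm_nonneg _) (hx1 _)).trans (hmax e he)
  have hA0 : A e0 ≠ 0 := norm_pos_iff.1 (hfpos.trans_le hle)
  obtain ⟨s, hs⟩ := exists_good_point hunir σ hσ T ε (by
    intro w hw e he
    let W : MvPolynomial (Fin N) (intRing k) := ∑ e ∈ T, MvPolynomial.monomial e (w e)
    have hWc : ∀ e, W.coeff e = if e ∈ T then w e else 0 := by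
      intro e
      simp only [W, MvPolynomial.coeff_sum, MvPolynomial.coeff_monomial]
      rw [Finset.sum_ite_eq']
    have hψW : ψ W = ∑ e ∈ T, algebraMap _ R (w e) * ε e := by
      simp only [W, map_sum]
      refine Finset.sum_congr rfl fun e _ => ?_
      rw [← Algebra.smul_def, ← map_smul, MvPolynomial.smul_monomial, smul_eq_mul, mul_one]
    have := hind W (by
      intro e' he'
      rw [MvPolynomial.mem_support_iff, hWc] at he'
      exact hTE e' (by by_contra hh; simp [hh] at he')) (by rw [hψW, hπ1, hw]) e
    rwa [hWc, if_pos he] at this) A e0 he0 hA0 hmax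
  let y : R →+* K := (σ.comp (intRing k).subtype).comp s.toRingHom
  have hy : ∀ r, y r = σ (s r : k) := fun r => rfl
  have hyc : ∀ c : intRing k, y (algebraMap (intRing k) R c) = σ c := fun c => by
    rw [hy, s.commutes]
    rfl
  have hy1 : ∀ r, ‖y r‖ ≤ 1 := fun r => by
    rw [hy, hσ]
    exact (s r).2
  have hval : ‖A e0‖ ≤ ‖∑ i, c i * y (r i)‖ := by
    by_contra! hcon
    have h1 : ∑ e ∈ T, A e * y (ε e) =
        ∑ i, c i * y (r i) - ∑ i, c i * (σ ((a : k) ^ n) * y (h i)) := by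
      rw [hexp y hyc]
      ring
    have h2 := IsUltrametricDist.norm_add_le_max (∑ i, c i * y (r i))
      (-∑ i, c i * (σ ((a : k) ^ n) * y (h i)))
    rw [← sub_eq_add_neg, ← h1, norm_neg] at h2
    exact absurd (le_trans hs h2)
      (not_le.2 (max_lt hcon (((hsmall y hy1).trans_lt hn).trans_le hle)))
  refine (hle.trans hval).trans (le_csSup ⟨C, ?_⟩ ⟨s.toRingHom, s.commutes, rfl⟩)
  rintro t ⟨s', -, rfl⟩
  refine norm_sum_le_of _ _ _ hC0 fun i _ => ?_
  rw [norm_mul, hσ]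
  exact (mul_le_of_le_one_right (norm_nonneg _) (s' (r i)).2).trans (hC i)

end Final

set_option synthInstance.maxHeartbeats 1000000 in
set_option maxHeartbeats 2000000 in

/-- let `k` have infinite residue field `k̃ = k°/k°°` and let
`𝒢 = Spec R` be a smooth affine group scheme over `k°` (`R` a finitely presented,
formally smooth Hopf algebra over `k°`, presented as a quotient of a polynomial ring,
i.e. a closed subscheme of affine space, in particular of `GLₙ`), with connected fibers,
whose special fiber `Spec (k̃ ⊗ R)` is unirational over `k̃` (its fraction field embeds in
a rational function field). Then for every analytic extension `(K, σ)` of `k`, the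
`K`-holomorphically convex envelope of `𝒢(k°)` is `𝒢(K°)`: a `K`-point `x` of `𝒢`
satisfies `|f(x)| ≤ sup_{s ∈ 𝒢(k°)} |f(s)|` for every regular function `f` on `𝒢_K`
(a `K`-linear combination of elements of `R`) if and only if `x` takes values in `K°`. -/
theorem stmt13 (k : Type u) [NontriviallyNormedField k] [IsUltrametricDist k] [CompleteSpace k]
    [Infinite ((intRing k) ⧸ (maxIdeal k))]
    (R : Type u) [CommRing R] [Algebra (intRing k) R]
    [HopfAlgebra (intRing k) R]
    [Algebra.FormallySmooth (intRing k) R] [Algebra.FinitePresentation (intRing k) R]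
    (hemb : ∃ (N : ℕ) (ψ : MvPolynomial (Fin N) (intRing k) →ₐ[intRing k] R),
      Function.Surjective ψ)
    (hconn₁ : ConnectedSpace (PrimeSpectrum (k ⊗[intRing k] R)))
    (hconn₂ : ConnectedSpace (PrimeSpectrum (((intRing k) ⧸ (maxIdeal k)) ⊗[intRing k] R)))
    (hunir : ∃ (N : ℕ)
      (φ : (((intRing k) ⧸ (maxIdeal k)) ⊗[intRing k] R) →ₐ[(intRing k) ⧸ (maxIdeal k)]
        FractionRing (MvPolynomial (Fin N) ((intRing k) ⧸ (maxIdeal k)))),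
      Function.Injective φ)
    (K : Type*) [NontriviallyNormedField K] [IsUltrametricDist K] [CompleteSpace K]
    (σ : k →+* K) (hσ : ∀ c : k, ‖σ c‖ = ‖c‖)
    (x : R →+* K) (hx : ∀ c : intRing k, x (algebraMap (intRing k) R c) = σ c) :
    (∀ (m : ℕ) (c : Fin m → K) (r : Fin m → R),
        ‖∑ i, c i * x (r i)‖ ≤
          sSup {t : ℝ | ∃ s : R →+* intRing k,
            (∀ a : intRing k, s (algebraMap (intRing k) R a) = a) ∧
            t = ‖∑ i, c i * σ ((s (r i) : intRing k) : k)‖}) ↔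
      ∀ r : R, ‖x r‖ ≤ 1 := by
  constructor
  · intro h r
    have h1 := h 1 (fun _ => 1) (fun _ => r)
    simp only [Finset.univ_unique, Finset.sum_singleton, one_mul] at h1
    refine h1.trans (Real.sSup_le ?_ zero_le_one)
    rintro t ⟨s, -, rfl⟩
    rw [hσ]
    exact (s r).2
  · intro hx1 m c r
    exact main_hard R hemb hunir K σ hσ x hx hx1 m c r
end
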